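/- arXiv:math/9802027 — 2 statements merged into one kernel-verified Lean document; each statement's English description precedes it below -/
import Mathlib

section
/- (Theorem 4.2) Suppose (P,Q,R,S) on U and (P̃,Q̃,R̃,S̃) on Ũ are related by the point-transformation rule via φ, and that the tilde coefficients are in special form of intermediate degeneration: Ã = 0, B̃ = 1 and P̃ = 0 identically on Ũ. Assume A ≠ 0 on U. Set φ̃₁ = −(6/5)·Q̃, φ̃₂ = −(3/5)·R̃ and define φ_i = Σ_j T^j_i·(φ̃_j∘φ) − (∂_i det T)/(det T) for i = 1,2. Then on U: φ₁ = −3·(B·P + A_{1.0})/(5·A) + (3/5)·Q and φ₂ = 3·B·(B·P + A_{1.0})/(5·A²) − 3·(B_{1.0} + A_{0.1} + 3·B·Q)/(5·A) + (6/5)·R. -/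
noncomputable section

open Real

/-- Partial derivative in the first argument (`f_{1.0}`). -/
def pdx (f : ℝ → ℝ → ℝ) : ℝ → ℝ → ℝ := fun x y => deriv (fun t => f t y) x

/-- Partial derivative in the second argument (`f_{0.1}`). -/
def pdy (f : ℝ → ℝ → ℝ) : ℝ → ℝ → ℝ := fun x y => deriv (fun t => f x t) y

/-- Indexed partial derivative: `0 ↦ ∂/∂x`, `1 ↦ ∂/∂y`. -/
def pd (i : Fin 2) (f : ℝ → ℝ → ℝ) : ℝ → ℝ → ℝ := if i = 0 then pdx f else pdy f

/-- Smoothness of a two-variable real function on a set `U ⊆ ℝ²`. -/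
def Smooth2 (U : Set (ℝ × ℝ)) (f : ℝ → ℝ → ℝ) : Prop :=
  ContDiffOn ℝ (⊤ : ℕ∞) (Function.uncurry f) U

/-- The quantity `A` of formula (1.6). -/
def coefA (P Q R S : ℝ → ℝ → ℝ) : ℝ → ℝ → ℝ := fun x y =>
  pdy (pdy P) x y - 2 * pdx (pdy Q) x y + pdx (pdx R) x y
    + 2 * P x y * pdx S x y + S x y * pdx P x y
    - 3 * P x y * pdy R x y - 3 * R x y * pdy P x y
    - 3 * Q x y * pdx R x y + 6 * Q x y * pdy Q x y

/-- The quantity `B` of formula (1.6). -/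
def coefB (P Q R S : ℝ → ℝ → ℝ) : ℝ → ℝ → ℝ := fun x y =>
  pdx (pdx S) x y - 2 * pdx (pdy R) x y + pdy (pdy Q) x y
    - 2 * S x y * pdy P x y - P x y * pdy S x y
    + 3 * S x y * pdx Q x y + 3 * Q x y * pdx S x y
    + 3 * R x y * pdy Q x y - 6 * R x y * pdx R x y

/-- The fully covariant symbol `θ_{ijk}` of (2.7) built from the ODE coefficients. -/
def thetaLow (P Q R S : ℝ → ℝ → ℝ) (i j k : Fin 2) : ℝ → ℝ → ℝ :=
  match i.1 + j.1 + k.1 with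
  | 0 => P
  | 1 => Q
  | 2 => R
  | _ => S

/-- The symbol `θ^k_{ij}` of (2.8), obtained by raising the first index with `d^{kr}`. -/
def thetaUp (P Q R S : ℝ → ℝ → ℝ) (k i j : Fin 2) : ℝ → ℝ → ℝ :=
  if k = 0 then thetaLow P Q R S 1 i j
  else fun x y => -(thetaLow P Q R S 0 i j x y)

/-- Jacobian matrix entry `T^p_i = ∂x̃^p/∂x^i` of the point transformation `φ = (xt, yt)`. -/
def Jmat (xt yt : ℝ → ℝ → ℝ) (p i : Fin 2) : ℝ → ℝ → ℝ :=
  pd i (if p = 0 then xt else yt)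

/-- The Jacobian determinant `det T`. -/
def Jdet (xt yt : ℝ → ℝ → ℝ) : ℝ → ℝ → ℝ := fun x y =>
  Jmat xt yt 0 0 x y * Jmat xt yt 1 1 x y - Jmat xt yt 0 1 x y * Jmat xt yt 1 0 x y

/-- The pointwise inverse Jacobian matrix `S = T⁻¹`. -/
def Jinv (xt yt : ℝ → ℝ → ℝ) (k m : Fin 2) : ℝ → ℝ → ℝ := fun x y =>
  (if k = 0 then (if m = 0 then Jmat xt yt 1 1 x y else -(Jmat xt yt 0 1 x y))
   else (if m = 0 then -(Jmat xt yt 1 0 x y) else Jmat xt yt 0 0 x y)) / Jdet xt yt x y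

/-- `σ̃_i = ∂_i (det T) / det T`. -/
def sigmaT (xt yt : ℝ → ℝ → ℝ) (i : Fin 2) : ℝ → ℝ → ℝ := fun x y =>
  pd i (Jdet xt yt) x y / Jdet xt yt x y

/-- The two coefficient systems are related by the point-transformation rule (2.9). -/
def PointRelated (U : Set (ℝ × ℝ)) (xt yt P Q R S Pt Qt Rt St : ℝ → ℝ → ℝ) : Prop :=
  ∀ i j k : Fin 2, ∀ x y : ℝ, (x, y) ∈ U →
    thetaUp P Q R S k i j x y =
      (∑ m : Fin 2, ∑ p : Fin 2, ∑ q : Fin 2,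
        Jinv xt yt k m x y * Jmat xt yt p i x y * Jmat xt yt q j x y *
          thetaUp Pt Qt Rt St m p q (xt x y) (yt x y))
      + (∑ m : Fin 2, Jinv xt yt k m x y * pd j (Jmat xt yt m i) x y)
      - (sigmaT xt yt i x y * (if k = j then (1:ℝ) else 0)
          + sigmaT xt yt j x y * (if k = i then (1:ℝ) else 0)) / 3

/-- The quantities `φ̃_j` in special coordinates: `φ̃₁ = −(6/5)·Q̃`, `φ̃₂ = −(3/5)·R̃`. -/
def phiSpec (Qt Rt : ℝ → ℝ → ℝ) (j : Fin 2) : ℝ → ℝ → ℝ :=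
  if j = 0 then fun x y => -(6/5) * Qt x y else fun x y => -(3/5) * Rt x y

/-- The quantities `φ_i = Σ_j T^j_i·(φ̃_j∘φ) − σ̃_i` of (4.13). -/
def phiPull (xt yt Qt Rt : ℝ → ℝ → ℝ) (i : Fin 2) : ℝ → ℝ → ℝ := fun x y =>
  (∑ j : Fin 2, Jmat xt yt j i x y * phiSpec Qt Rt j (xt x y) (yt x y))
    - pd i (Jdet xt yt) x y / Jdet xt yt x y


theorem alg_cotton {A : Type*} [CommRing A] (D1 D2 : Derivation ℤ A A)
    (hc : ∀ f, D2 (D1 f) = D1 (D2 f)) (P Q R S K11 K12 K22 : A)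
    (h11 : K11 = D1 Q - D2 P - 2 * (Q * Q) + 2 * (R * P))
    (h12 : K12 = D1 R - D2 Q - Q * R + P * S)
    (h22 : K22 = D1 S - D2 R - 2 * (R * R) + 2 * (S * Q)) :
    D1 K12 - D2 K11 - 2 * Q * K12 + P * K22 + R * K11 =
      D2 (D2 P) - 2 * D1 (D2 Q) + D1 (D1 R)
    + 2 * P * D1 S + S * D1 P
    - 3 * P * D2 R - 3 * R * D2 P
    - 3 * Q * D1 R + 6 * Q * D2 Q ∧
    D1 K22 - D2 K12 - 2 * R * K12 + Q * K22 + S * K11 =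
      D1 (D1 S) - 2 * D1 (D2 R) + D2 (D2 Q)
    - 2 * S * D2 P - P * D2 S
    + 3 * S * D1 Q + 3 * Q * D1 S
    + 3 * R * D2 Q - 6 * R * D1 R := by
  have t1 : D1 2 = 0 := by simpa using D1.map_natCast 2
  have t2 : D2 2 = 0 := by simpa using D2.map_natCast 2
  subst h11 h12 h22
  simp only [map_sub, map_add, Derivation.leibniz, smul_eq_mul, hc, t1, t2]
  constructor <;> ring

theorem alg_law {A : Type*} [CommRing A] (D1 D2 : Derivation ℤ A A)
    (hc : ∀ f, D2 (D1 f) = D1 (D2 f)) (P Q R S K11 K12 K22 : A)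
    (h11 : K11 = D1 Q - D2 P - 2 * (Q * Q) + 2 * (R * P))
    (h12 : K12 = D1 R - D2 Q - Q * R + P * S)
    (h22 : K22 = D1 S - D2 R - 2 * (R * R) + 2 * (S * Q))
    (a b c d u v : A) (hJ : IsUnit (3 * (a * d - b * c)))
    (hu : D1 (a * d - b * c) = 3 * u * (a * d - b * c))
    (hv : D2 (a * d - b * c) = 3 * v * (a * d - b * c))
    (p q r s px py qx qy rx ry sx sy k11 k12 k22 x11 x12 x22 y11 y12 y22 : A)
    (hp1 : D1 p = a * px + c * py) (hp2 : D2 p = b * px + d * py)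
    (hq1 : D1 q = a * qx + c * qy) (hq2 : D2 q = b * qx + d * qy)
    (hr1 : D1 r = a * rx + c * ry) (hr2 : D2 r = b * rx + d * ry)
    (hs1 : D1 s = a * sx + c * sy) (hs2 : D2 s = b * sx + d * sy)
    (g11 : k11 = qx - py - 2 * (q * q) + 2 * (r * p))
    (g12 : k12 = rx - qy - q * r + p * s)
    (g22 : k22 = sx - ry - 2 * (r * r) + 2 * (s * q))
    (h1k11 : D1 k11 = a * x11 + c * y11) (h2k11 : D2 k11 = b * x11 + d * y11)
    (h1k12 : D1 k12 = a * x12 + c * y12) (h2k12 : D2 k12 = b * x12 + d * y12)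
    (h1k22 : D1 k22 = a * x22 + c * y22) (h2k22 : D2 k22 = b * x22 + d * y22)
    (h1a : D1 a = a * Q - b * P - (q * (a * a) + 2 * (r * (a * c)) + s * (c * c)) + 2 * (u * a))
    (h2a : D2 a = a * R - b * Q - (q * (a * b) + r * (a * d + b * c) + s * (c * d))
      + u * b + v * a)
    (h1b : D1 b = a * R - b * Q - (q * (a * b) + r * (a * d + b * c) + s * (c * d))
      + u * b + v * a)
    (h2b : D2 b = a * S - b * R - (q * (b * b) + 2 * (r * (b * d)) + s * (d * d)) + 2 * (v * b))
    (h1c : D1 c = c * Q - d * P + (p * (a * a) + 2 * (q * (a * c)) + r * (c * c)) + 2 * (u * c))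
    (h2c : D2 c = c * R - d * Q + (p * (a * b) + q * (a * d + b * c) + r * (c * d))
      + u * d + v * c)
    (h1d : D1 d = c * R - d * Q + (p * (a * b) + q * (a * d + b * c) + r * (c * d))
      + u * d + v * c)
    (h2d : D2 d = c * S - d * R + (p * (b * b) + 2 * (q * (b * d)) + r * (d * d)) + 2 * (v * d)) :
    D1 K12 - D2 K11 - 2 * Q * K12 + P * K22 + R * K11 =
      (a * d - b * c) * (a * (x12 - y11 - 2 * q * k12 + p * k22 + r * k11) +
        c * (x22 - y12 - 2 * r * k12 + q * k22 + s * k11)) ∧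
    D1 K22 - D2 K12 - 2 * R * K12 + Q * K22 + S * K11 =
      (a * d - b * c) * (b * (x12 - y11 - 2 * q * k12 + p * k22 + r * k11) +
        d * (x22 - y12 - 2 * r * k12 + q * k22 + s * k11)) := by
  have t1 : D1 2 = 0 := by simpa using D1.map_natCast 2
  have t2 : D2 2 = 0 := by simpa using D2.map_natCast 2
  have t3 : D1 3 = 0 := by simpa using D1.map_natCast 3
  have t4 : D2 3 = 0 := by simpa using D2.map_natCast 3
  have hreg : ∀ f g : A, 3 * (a * d - b * c) * f = 3 * (a * d - b * c) * g → f = g :=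
    fun f g h => hJ.mul_left_cancel h
  have huv : D2 u = D1 v := by
    apply hreg
    have e := hc (a * d - b * c)
    rw [hu, hv] at e
    simp only [Derivation.leibniz, smul_eq_mul, t3, t4, hu, hv] at e
    linear_combination e
  have ea := hc a
  have eb := hc b
  have ec := hc c
  have ed := hc d
  rw [h1a, h2a] at ea
  rw [h1b, h2b] at eb
  rw [h1c, h2c] at ec
  rw [h1d, h2d] at ed
  simp only [map_sub, map_add, Derivation.leibniz, smul_eq_mul, t1, t2, h1a, h2a, h1b, h2b,
    h1c, h2c, h1d, h2d, hp1, hp2, hq1, hq2, hr1, hr2, hs1, hs2, huv] at ea eb ec ed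
  have l11 : K11 = a * a * k11 + 2 * (a * c * k12) + c * c * k22 + D1 u - Q * u + P * v - u * u := by
    apply hreg
    rw [h11, g11, g12, g22]
    linear_combination 3 * (-c * ea + a * ec)
  have l12 : K12 = a * b * k11 + (a * d + b * c) * k12 + c * d * k22
      + D1 v - R * u + Q * v - u * v := by
    apply hreg
    rw [h12, g11, g12, g22]
    linear_combination 3 * (-d * ea + b * ec)
  have l22 : K22 = b * b * k11 + 2 * (b * d * k12) + d * d * k22 + D2 v - S * u + R * v - v * v := by
    apply hreg
    rw [h22, g11, g12, g22]
    linear_combination 3 * (-d * eb + b * ed)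
  have m1 : D1 K12 = D1 (a * b * k11 + (a * d + b * c) * k12 + c * d * k22
      + D1 v - R * u + Q * v - u * v) := by rw [← l12]
  have m2 : D2 K12 = D2 (a * b * k11 + (a * d + b * c) * k12 + c * d * k22
      + D1 v - R * u + Q * v - u * v) := by rw [← l12]
  have m3 : D2 K11 = D2 (a * a * k11 + 2 * (a * c * k12) + c * c * k22
      + D1 u - Q * u + P * v - u * u) := by rw [← l11]
  have m4 : D1 K22 = D1 (b * b * k11 + 2 * (b * d * k12) + d * d * k22
      + D2 v - S * u + R * v - v * v) := by rw [← l22]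
  simp only [map_sub, map_add, Derivation.leibniz, smul_eq_mul, t1, t2, h1a, h2a, h1b, h2b,
    h1c, h2c, h1d, h2d, h1k11, h2k11, h1k12, h2k12, h1k22, h2k22, hc, huv] at m1 m2 m3 m4
  constructor
  · rw [m1, m3]
    linear_combination (-2 * Q) * l12 + P * l22 + R * l11 + u * h12 - v * h11 - u * l12 + v * l11
  · rw [m2, m4]
    linear_combination (-2 * R) * l12 + Q * l22 + S * l11 + u * h22 - v * h12 - u * l22 + v * l12

/-- Coordinate vectors. -/
def ebas (i : Fin 2) : ℝ × ℝ := if i = 0 then (1, 0) else (0, 1)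

theorem pd_hasDeriv {U : Set (ℝ × ℝ)} (hU : IsOpen U) {f : ℝ → ℝ → ℝ} (hf : Smooth2 U f)
    {x y : ℝ} (h : (x, y) ∈ U) : HasFDerivAt (Function.uncurry f)
      (fderiv ℝ (Function.uncurry f) (x, y)) (x, y) :=
  ((hf.contDiffAt (hU.mem_nhds h)).differentiableAt (by simp)).hasFDerivAt

theorem pd_eq {f : ℝ → ℝ → ℝ} {x y : ℝ} {L : ℝ × ℝ →L[ℝ] ℝ}
    (h : HasFDerivAt (Function.uncurry f) L (x, y)) (i : Fin 2) : pd i f x y = L (ebas i) := by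
  fin_cases i
  · have h1 : HasDerivAt (fun t : ℝ => (t, y)) ((1 : ℝ), (0 : ℝ)) x :=
      (hasDerivAt_id x).prodMk (hasDerivAt_const x y)
    have := h.comp_hasDerivAt x h1
    exact this.deriv
  · have h1 : HasDerivAt (fun t : ℝ => (x, t)) ((0 : ℝ), (1 : ℝ)) y :=
      (hasDerivAt_const y x).prodMk (hasDerivAt_id y)
    have := h.comp_hasDerivAt y h1
    exact this.deriv

theorem pd_eq_fderiv {U : Set (ℝ × ℝ)} (hU : IsOpen U) {f : ℝ → ℝ → ℝ} (hf : Smooth2 U f)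
    {x y : ℝ} (h : (x, y) ∈ U) (i : Fin 2) :
    pd i f x y = fderiv ℝ (Function.uncurry f) (x, y) (ebas i) :=
  pd_eq (pd_hasDeriv hU hf h) i

theorem smooth2_congr {U : Set (ℝ × ℝ)} {f g : ℝ → ℝ → ℝ} (hf : Smooth2 U f)
    (h : ∀ x y, (x, y) ∈ U → g x y = f x y) : Smooth2 U g :=
  ContDiffOn.congr hf (fun p hp => h p.1 p.2 hp)

theorem smooth2_pd {U : Set (ℝ × ℝ)} (hU : IsOpen U) {f : ℝ → ℝ → ℝ} (hf : Smooth2 U f)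
    (i : Fin 2) : Smooth2 U (pd i f) := by
  have h1 : ContDiffOn ℝ (⊤ : ℕ∞) (fderiv ℝ (Function.uncurry f)) U :=
    hf.fderiv_of_isOpen hU (by simp)
  have h2 : ContDiffOn ℝ (⊤ : ℕ∞) (fun p => fderiv ℝ (Function.uncurry f) p (ebas i)) U :=
    h1.clm_apply contDiffOn_const
  exact h2.congr (fun p hp => pd_eq_fderiv hU hf (x := p.1) (y := p.2) hp i)

theorem pd_congr {U : Set (ℝ × ℝ)} (hU : IsOpen U) {f g : ℝ → ℝ → ℝ} (hf : Smooth2 U f)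
    (h : ∀ x y, (x, y) ∈ U → g x y = f x y) {x y : ℝ} (hp : (x, y) ∈ U) (i : Fin 2) :
    pd i g x y = pd i f x y := by
  rw [pd_eq_fderiv hU hf hp, pd_eq_fderiv hU (smooth2_congr hf h) hp]
  congr 1
  apply Filter.EventuallyEq.fderiv_eq
  filter_upwards [hU.mem_nhds hp] with q hq
  exact h q.1 q.2 hq

theorem pd_comm {U : Set (ℝ × ℝ)} (hU : IsOpen U) {f : ℝ → ℝ → ℝ} (hf : Smooth2 U f)
    {x y : ℝ} (hp : (x, y) ∈ U) (i j : Fin 2) : pd i (pd j f) x y = pd j (pd i f) x y := by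
  have h1 : ContDiffOn ℝ (⊤ : ℕ∞) (fderiv ℝ (Function.uncurry f)) U :=
    hf.fderiv_of_isOpen hU (by simp)
  have hd : HasFDerivAt (fderiv ℝ (Function.uncurry f))
      (fderiv ℝ (fderiv ℝ (Function.uncurry f)) (x, y)) (x, y) :=
    ((h1.contDiffAt (hU.mem_nhds hp)).differentiableAt (by simp)).hasFDerivAt
  have key : ∀ i j : Fin 2, pd i (pd j f) x y =
      fderiv ℝ (fderiv ℝ (Function.uncurry f)) (x, y) (ebas i) (ebas j) := by
    intro i j
    have e : HasFDerivAt (fun p => fderiv ℝ (Function.uncurry f) p (ebas j))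
      ((fderiv ℝ (fderiv ℝ (Function.uncurry f)) (x, y)).flip (ebas j)) (x, y) := by
      simpa using hd.clm_apply (hasFDerivAt_const (ebas j) (x, y))
    have e2 : HasFDerivAt (Function.uncurry (pd j f))
      ((fderiv ℝ (fderiv ℝ (Function.uncurry f)) (x, y)).flip (ebas j)) (x, y) := by
      apply e.congr_of_eventuallyEq
      filter_upwards [hU.mem_nhds hp] with q hq
      exact pd_eq_fderiv hU hf (x := q.1) (y := q.2) hq j
    rw [pd_eq e2]
    rfl
  rw [key, key]
  exact (hf.contDiffAt (hU.mem_nhds hp)).isSymmSndFDerivAt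
    (by simp only [minSmoothness_of_isRCLikeNormedField]; exact WithTop.coe_le_coe.2 (le_top : (2 : ℕ∞) ≤ ⊤)) (ebas i) (ebas j)

theorem smooth2_comp {U Ut : Set (ℝ × ℝ)} {xt yt : ℝ → ℝ → ℝ}
    (hxt : Smooth2 U xt) (hyt : Smooth2 U yt)
    (hmaps : ∀ x y : ℝ, (x, y) ∈ U → (xt x y, yt x y) ∈ Ut) {f : ℝ → ℝ → ℝ}
    (hf : Smooth2 Ut f) : Smooth2 U (fun x y => f (xt x y) (yt x y)) :=
  ContDiffOn.comp (g := Function.uncurry f)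
    (f := fun p : ℝ × ℝ => (xt p.1 p.2, yt p.1 p.2)) (t := Ut) hf (ContDiffOn.prodMk hxt hyt)
    (fun p hp => hmaps p.1 p.2 hp)

theorem pd_comp {U Ut : Set (ℝ × ℝ)} (hU : IsOpen U) (hUt : IsOpen Ut) {xt yt : ℝ → ℝ → ℝ}
    (hxt : Smooth2 U xt) (hyt : Smooth2 U yt)
    (hmaps : ∀ x y : ℝ, (x, y) ∈ U → (xt x y, yt x y) ∈ Ut) {f : ℝ → ℝ → ℝ}
    (hf : Smooth2 Ut f) {x y : ℝ} (hp : (x, y) ∈ U) (i : Fin 2) :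
    pd i (fun x y => f (xt x y) (yt x y)) x y =
      pd i xt x y * pd 0 f (xt x y) (yt x y) + pd i yt x y * pd 1 f (xt x y) (yt x y) := by
  have h1 := pd_hasDeriv hU hxt hp
  have h2 := pd_hasDeriv hU hyt hp
  have h3 := pd_hasDeriv hUt hf (hmaps x y hp)
  have h4 : HasFDerivAt (fun p : ℝ × ℝ => (Function.uncurry xt p, Function.uncurry yt p)) _ (x, y) :=
    h1.prodMk h2
  have h5 := HasFDerivAt.comp (x, y) (g := Function.uncurry f) h3 h4
  rw [pd_eq (f := fun x y => f (xt x y) (yt x y)) h5 i, pd_eq h1 i, pd_eq h2 i, pd_eq h3 0, pd_eq h3 1]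
  set L := fderiv ℝ (Function.uncurry f) (xt x y, yt x y)
  have hL : ∀ s t : ℝ, L (s, t) = s * L (ebas 0) + t * L (ebas 1) := by
    intro s t
    have : ((s, t) : ℝ × ℝ) = s • ebas 0 + t • ebas 1 := by simp [ebas]
    rw [this, map_add, map_smul, map_smul]; simp
  exact hL _ _

theorem pd_add {U : Set (ℝ × ℝ)} (hU : IsOpen U) {f g : ℝ → ℝ → ℝ} (hf : Smooth2 U f)
    (hg : Smooth2 U g) {x y : ℝ} (hp : (x, y) ∈ U) (i : Fin 2) :
    pd i (f + g) x y = pd i f x y + pd i g x y := by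
  have h1 := pd_hasDeriv hU hf hp
  have h2 := pd_hasDeriv hU hg hp
  rw [pd_eq h1, pd_eq h2, pd_eq (f := f + g) (h1.add h2)]
  rfl

theorem pd_mul {U : Set (ℝ × ℝ)} (hU : IsOpen U) {f g : ℝ → ℝ → ℝ} (hf : Smooth2 U f)
    (hg : Smooth2 U g) {x y : ℝ} (hp : (x, y) ∈ U) (i : Fin 2) :
    pd i (f * g) x y = f x y * pd i g x y + g x y * pd i f x y := by
  have h1 := pd_hasDeriv hU hf hp
  have h2 := pd_hasDeriv hU hg hp
  rw [pd_eq h1, pd_eq h2, pd_eq (f := f * g) (h1.mul h2)]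
  rfl

/-- The ring of functions smooth on `U`. -/
def SmR (U : Set (ℝ × ℝ)) : Subring (ℝ → ℝ → ℝ) where
  carrier := {f | Smooth2 U f}
  mul_mem' := fun {_ _} hf hg => ContDiffOn.mul hf hg
  one_mem' := contDiffOn_const (c := (1 : ℝ))
  add_mem' := fun {_ _} hf hg => ContDiffOn.add hf hg
  zero_mem' := contDiffOn_const (c := (0 : ℝ))
  neg_mem' := fun {_} hf => ContDiffOn.neg hf

open Classical in
/-- Truncate a function smooth on `U` to a constant outside `U`. -/
def cut {U : Set (ℝ × ℝ)} (c : ℝ) (f : ℝ → ℝ → ℝ) (hf : Smooth2 U f) : SmR U :=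
  ⟨fun x y => if (x, y) ∈ U then f x y else c,
    smooth2_congr hf (fun x y h => by simp [h])⟩

theorem cut_in {U : Set (ℝ × ℝ)} (c : ℝ) (f : ℝ → ℝ → ℝ) (hf : Smooth2 U f) {x y : ℝ}
    (h : (x, y) ∈ U) : (cut c f hf : ℝ → ℝ → ℝ) x y = f x y := by simp [cut, h]

theorem cut_out {U : Set (ℝ × ℝ)} (c : ℝ) (f : ℝ → ℝ → ℝ) (hf : Smooth2 U f) {x y : ℝ}
    (h : (x, y) ∉ U) : (cut c f hf : ℝ → ℝ → ℝ) x y = c := by simp [cut, h]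

theorem smr_ext {U : Set (ℝ × ℝ)} {F G : SmR U}
    (h1 : ∀ x y, (x, y) ∈ U → (F : ℝ → ℝ → ℝ) x y = (G : ℝ → ℝ → ℝ) x y)
    (h2 : ∀ x y, (x, y) ∉ U → (F : ℝ → ℝ → ℝ) x y = (G : ℝ → ℝ → ℝ) x y) : F = G := by
  apply Subtype.ext
  funext x y
  by_cases h : (x, y) ∈ U
  · exact h1 x y h
  · exact h2 x y h

/-- The partial derivatives as derivations of the ring `SmR U`. -/
def DD {U : Set (ℝ × ℝ)} (hU : IsOpen U) (i : Fin 2) : Derivation ℤ (SmR U) (SmR U) :=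
  Derivation.mk'
    (AddMonoidHom.toIntLinearMap
      (AddMonoidHom.mk' (fun F : SmR U => cut 0 (pd i F.1) (smooth2_pd hU F.2 i))
        (fun F G => smr_ext
          (fun x y h => by
            simp only [Subring.coe_add, Pi.add_apply, cut_in _ _ _ h]
            exact pd_add hU F.2 G.2 h i)
          (fun x y h => by simp [cut_out _ _ _ h]))))
    (fun F G => smr_ext
      (fun x y h => by
        simp only [AddMonoidHom.coe_toIntLinearMap, AddMonoidHom.mk'_apply, smul_eq_mul,
          Subring.coe_add, Subring.coe_mul, Pi.add_apply, Pi.mul_apply, cut_in _ _ _ h]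
        exact pd_mul hU F.2 G.2 h i)
      (fun x y h => by simp [cut_out _ _ _ h]))

theorem DD_def {U : Set (ℝ × ℝ)} (hU : IsOpen U) (i : Fin 2) (F : SmR U) :
    DD hU i F = cut 0 (pd i F.1) (smooth2_pd hU F.2 i) := rfl

theorem DD_cut {U : Set (ℝ × ℝ)} (hU : IsOpen U) (i : Fin 2) (c : ℝ) (f : ℝ → ℝ → ℝ)
    (hf : Smooth2 U f) : DD hU i (cut c f hf) = cut 0 (pd i f) (smooth2_pd hU hf i) := by
  rw [DD_def]
  apply smr_ext
  · intro x y h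
    rw [cut_in _ _ _ h, cut_in _ _ _ h]
    exact pd_congr hU hf (fun x y h => cut_in _ _ _ h) h i
  · intro x y h
    rw [cut_out _ _ _ h, cut_out _ _ _ h]

theorem DD_comm {U : Set (ℝ × ℝ)} (hU : IsOpen U) (i j : Fin 2) (F : SmR U) :
    DD hU i (DD hU j F) = DD hU j (DD hU i F) := by
  rw [DD_def hU j F, DD_def hU i F, DD_cut, DD_cut]
  apply smr_ext
  · intro x y h
    rw [cut_in _ _ _ h, cut_in _ _ _ h]
    exact pd_comm hU F.2 h i j
  · intro x y h
    rw [cut_out _ _ _ h, cut_out _ _ _ h]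

/-- Ricci-type components. -/
def K11f (P Q R S : ℝ → ℝ → ℝ) : ℝ → ℝ → ℝ := fun x y =>
  pd 0 Q x y - pd 1 P x y - 2 * (Q x y * Q x y) + 2 * (R x y * P x y)

/-- Ricci-type components. -/
def K12f (P Q R S : ℝ → ℝ → ℝ) : ℝ → ℝ → ℝ := fun x y =>
  pd 0 R x y - pd 1 Q x y - Q x y * R x y + P x y * S x y

/-- Ricci-type components. -/
def K22f (P Q R S : ℝ → ℝ → ℝ) : ℝ → ℝ → ℝ := fun x y =>
  pd 0 S x y - pd 1 R x y - 2 * (R x y * R x y) + 2 * (S x y * Q x y)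

theorem smooth2_K {U : Set (ℝ × ℝ)} (hU : IsOpen U) {P Q R S : ℝ → ℝ → ℝ}
    (hP : Smooth2 U P) (hQ : Smooth2 U Q) (hR : Smooth2 U R) (hS : Smooth2 U S) :
    Smooth2 U (K11f P Q R S) ∧ Smooth2 U (K12f P Q R S) ∧ Smooth2 U (K22f P Q R S) := by
  have hQ0 := smooth2_pd hU hQ 0
  have hR0 := smooth2_pd hU hR 0
  have hS0 := smooth2_pd hU hS 0
  have hP1 := smooth2_pd hU hP 1
  have hQ1 := smooth2_pd hU hQ 1
  have hR1 := smooth2_pd hU hR 1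
  have h2 : ContDiffOn ℝ (⊤ : ℕ∞) (fun _ : ℝ × ℝ => (2 : ℝ)) U := contDiffOn_const
  refine ⟨?_, ?_, ?_⟩
  · exact ((ContDiffOn.sub hQ0 hP1).sub (h2.mul (ContDiffOn.mul hQ hQ))).add
      (h2.mul (ContDiffOn.mul hR hP))
  · exact ((ContDiffOn.sub hR0 hQ1).sub (ContDiffOn.mul hQ hR)).add (ContDiffOn.mul hP hS)
  · exact ((ContDiffOn.sub hS0 hR1).sub (h2.mul (ContDiffOn.mul hR hR))).add
      (h2.mul (ContDiffOn.mul hS hQ))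

theorem two_apply (U : Set (ℝ × ℝ)) (x y : ℝ) : ((2 : SmR U) : ℝ → ℝ → ℝ) x y = 2 := rfl
theorem three_apply (U : Set (ℝ × ℝ)) (x y : ℝ) : ((3 : SmR U) : ℝ → ℝ → ℝ) x y = 3 := rfl
theorem six_apply (U : Set (ℝ × ℝ)) (x y : ℝ) : ((6 : SmR U) : ℝ → ℝ → ℝ) x y = 6 := rfl
theorem add_app {U : Set (ℝ × ℝ)} (F G : SmR U) (x y : ℝ) :
    ((F + G : SmR U) : ℝ → ℝ → ℝ) x y = F.1 x y + G.1 x y := rfl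
theorem sub_app {U : Set (ℝ × ℝ)} (F G : SmR U) (x y : ℝ) :
    ((F - G : SmR U) : ℝ → ℝ → ℝ) x y = F.1 x y - G.1 x y := rfl
theorem mul_app {U : Set (ℝ × ℝ)} (F G : SmR U) (x y : ℝ) :
    ((F * G : SmR U) : ℝ → ℝ → ℝ) x y = F.1 x y * G.1 x y := rfl

theorem coef_K {U : Set (ℝ × ℝ)} (hU : IsOpen U) {P Q R S : ℝ → ℝ → ℝ}
    (hP : Smooth2 U P) (hQ : Smooth2 U Q) (hR : Smooth2 U R) (hS : Smooth2 U S)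
    {x y : ℝ} (h : (x, y) ∈ U) :
    coefA P Q R S x y = pd 0 (K12f P Q R S) x y - pd 1 (K11f P Q R S) x y
      - 2 * Q x y * K12f P Q R S x y + P x y * K22f P Q R S x y + R x y * K11f P Q R S x y ∧
    coefB P Q R S x y = pd 0 (K22f P Q R S) x y - pd 1 (K12f P Q R S) x y
      - 2 * R x y * K12f P Q R S x y + Q x y * K22f P Q R S x y + S x y * K11f P Q R S x y := by
  obtain ⟨k1, k2, k3⟩ := smooth2_K hU hP hQ hR hS
  obtain ⟨e1, e2⟩ := alg_cotton (DD hU 0) (DD hU 1) (fun F => DD_comm hU 1 0 F)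
    (cut 0 P hP) (cut 0 Q hQ) (cut 0 R hR) (cut 0 S hS)
    (cut 0 _ k1) (cut 0 _ k2) (cut 0 _ k3)
    (by
      simp only [DD_cut]
      apply smr_ext <;> intro x y h
      · simp only [add_app, sub_app, mul_app, two_apply, cut_in _ _ _ h]; rfl
      · simp only [add_app, sub_app, mul_app, two_apply, cut_out _ _ _ h]; ring)
    (by
      simp only [DD_cut]
      apply smr_ext <;> intro x y h
      · simp only [add_app, sub_app, mul_app, two_apply, cut_in _ _ _ h]; rfl
      · simp only [add_app, sub_app, mul_app, two_apply, cut_out _ _ _ h]; ring)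
    (by
      simp only [DD_cut]
      apply smr_ext <;> intro x y h
      · simp only [add_app, sub_app, mul_app, two_apply, cut_in _ _ _ h]; rfl
      · simp only [add_app, sub_app, mul_app, two_apply, cut_out _ _ _ h]; ring)
  have e1' := congrArg (fun F : SmR U => F.1 x y) e1
  have e2' := congrArg (fun F : SmR U => F.1 x y) e2
  simp only [DD_cut, add_app, sub_app, mul_app, two_apply, three_apply, six_apply,
    cut_in _ _ _ h] at e1' e2'
  exact ⟨e1'.symm, e2'.symm⟩

theorem inv_lemma {a b c d J X1 X2 e1 e2 t1 t2 : ℝ} (hJ : J = a * d - b * c) (h0 : J ≠ 0)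
    (h1 : t1 = (d * X1 - b * X2) / J - e1) (h2 : t2 = (-c * X1 + a * X2) / J - e2) :
    X1 = a * (t1 + e1) + b * (t2 + e2) ∧ X2 = c * (t1 + e1) + d * (t2 + e2) := by
  rw [h1, h2]
  constructor
  · field_simp
    rw [hJ]; ring
  · field_simp
    rw [hJ]; ring

/-- One third of the logarithmic derivative of the Jacobian. -/
def uf (xt yt : ℝ → ℝ → ℝ) (i : Fin 2) : ℝ → ℝ → ℝ := fun x y =>
  pd i (Jdet xt yt) x y / (3 * Jdet xt yt x y)

theorem rule_gen {U : Set (ℝ × ℝ)} {xt yt P Q R S Pt Qt Rt St : ℝ → ℝ → ℝ}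
    (hrel : PointRelated U xt yt P Q R S Pt Qt Rt St)
    (hdet : ∀ x y : ℝ, (x, y) ∈ U → Jdet xt yt x y ≠ 0) {x y : ℝ} (h : (x, y) ∈ U)
    (i j m : Fin 2) :
    pd j (Jmat xt yt m i) x y =
      (∑ k : Fin 2, Jmat xt yt m k x y * thetaUp P Q R S k i j x y)
      - (∑ p : Fin 2, ∑ q : Fin 2, Jmat xt yt p i x y * Jmat xt yt q j x y *
          thetaUp Pt Qt Rt St m p q (xt x y) (yt x y))
      + uf xt yt i x y * Jmat xt yt m j x y + uf xt yt j x y * Jmat xt yt m i x y := by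
  have h1 := hrel i j 0 x y h
  have h2 := hrel i j 1 x y h
  have hJ := hdet x y h
  obtain ⟨r1, r2⟩ := inv_lemma (a := Jmat xt yt 0 0 x y) (b := Jmat xt yt 0 1 x y)
    (c := Jmat xt yt 1 0 x y) (d := Jmat xt yt 1 1 x y)
    (X1 := (∑ p : Fin 2, ∑ q : Fin 2, Jmat xt yt p i x y * Jmat xt yt q j x y *
          thetaUp Pt Qt Rt St 0 p q (xt x y) (yt x y)) + pd j (Jmat xt yt 0 i) x y)
    (X2 := (∑ p : Fin 2, ∑ q : Fin 2, Jmat xt yt p i x y * Jmat xt yt q j x y *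
          thetaUp Pt Qt Rt St 1 p q (xt x y) (yt x y)) + pd j (Jmat xt yt 1 i) x y)
    (e1 := (sigmaT xt yt i x y * (if (0 : Fin 2) = j then (1:ℝ) else 0)
          + sigmaT xt yt j x y * (if (0 : Fin 2) = i then (1:ℝ) else 0)) / 3)
    (e2 := (sigmaT xt yt i x y * (if (1 : Fin 2) = j then (1:ℝ) else 0)
          + sigmaT xt yt j x y * (if (1 : Fin 2) = i then (1:ℝ) else 0)) / 3)
    (t1 := thetaUp P Q R S 0 i j x y) (t2 := thetaUp P Q R S 1 i j x y)
    (J := Jdet xt yt x y) rfl hJ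
    (by rw [h1]; simp [Fin.sum_univ_two, Jinv]; ring)
    (by rw [h2]; simp [Fin.sum_univ_two, Jinv]; ring)
  have hs : ∀ i, sigmaT xt yt i x y = 3 * uf xt yt i x y := by
    intro i
    simp only [sigmaT, uf]
    field_simp
  simp only [hs] at r1 r2
  fin_cases m
  · simp only [Fin.zero_eta, Fin.sum_univ_two] at r1 ⊢
    fin_cases i <;> fin_cases j <;> simp at r1 ⊢ <;> linear_combination r1
  · simp only [Fin.mk_one, Fin.sum_univ_two] at r2 ⊢
    fin_cases i <;> fin_cases j <;> simp at r2 ⊢ <;> linear_combination r2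

theorem rules {U : Set (ℝ × ℝ)} {xt yt P Q R S Pt Qt Rt St : ℝ → ℝ → ℝ}
    (hrel : PointRelated U xt yt P Q R S Pt Qt Rt St)
    (hdet : ∀ x y : ℝ, (x, y) ∈ U → Jdet xt yt x y ≠ 0) {x y : ℝ} (h : (x, y) ∈ U)
    {a b c d u v p q r s X Y : ℝ}
    (ha : a = Jmat xt yt 0 0 x y) (hb : b = Jmat xt yt 0 1 x y)
    (hc : c = Jmat xt yt 1 0 x y) (hd : d = Jmat xt yt 1 1 x y)
    (hu : u = uf xt yt 0 x y) (hv : v = uf xt yt 1 x y)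
    (hX : X = xt x y) (hY : Y = yt x y)
    (hp : p = Pt X Y) (hq : q = Qt X Y) (hr : r = Rt X Y) (hs : s = St X Y) :
    pd 0 (Jmat xt yt 0 0) x y = a * Q x y - b * P x y
      - (q * (a * a) + 2 * (r * (a * c)) + s * (c * c)) + 2 * (u * a) ∧
    pd 1 (Jmat xt yt 0 0) x y = a * R x y - b * Q x y
      - (q * (a * b) + r * (a * d + b * c) + s * (c * d)) + u * b + v * a ∧
    pd 0 (Jmat xt yt 0 1) x y = a * R x y - b * Q x y
      - (q * (a * b) + r * (a * d + b * c) + s * (c * d)) + u * b + v * a ∧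
    pd 1 (Jmat xt yt 0 1) x y = a * S x y - b * R x y
      - (q * (b * b) + 2 * (r * (b * d)) + s * (d * d)) + 2 * (v * b) ∧
    pd 0 (Jmat xt yt 1 0) x y = c * Q x y - d * P x y
      + (p * (a * a) + 2 * (q * (a * c)) + r * (c * c)) + 2 * (u * c) ∧
    pd 1 (Jmat xt yt 1 0) x y = c * R x y - d * Q x y
      + (p * (a * b) + q * (a * d + b * c) + r * (c * d)) + u * d + v * c ∧
    pd 0 (Jmat xt yt 1 1) x y = c * R x y - d * Q x y
      + (p * (a * b) + q * (a * d + b * c) + r * (c * d)) + u * d + v * c ∧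
    pd 1 (Jmat xt yt 1 1) x y = c * S x y - d * R x y
      + (p * (b * b) + 2 * (q * (b * d)) + r * (d * d)) + 2 * (v * d) := by
  subst hX hY
  subst ha hb hc hd hu hv hp hq hr hs
  refine ⟨?_, ?_, ?_, ?_, ?_, ?_, ?_, ?_⟩ <;> rw [rule_gen hrel hdet h] <;>
    simp [Fin.sum_univ_two, thetaUp, thetaLow] <;> ring

theorem smooth2_Jmat {U : Set (ℝ × ℝ)} (hU : IsOpen U) {xt yt : ℝ → ℝ → ℝ}
    (hxt : Smooth2 U xt) (hyt : Smooth2 U yt) (p i : Fin 2) : Smooth2 U (Jmat xt yt p i) := by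
  unfold Jmat
  split_ifs
  · exact smooth2_pd hU hxt i
  · exact smooth2_pd hU hyt i

theorem smooth2_Jdet {U : Set (ℝ × ℝ)} (hU : IsOpen U) {xt yt : ℝ → ℝ → ℝ}
    (hxt : Smooth2 U xt) (hyt : Smooth2 U yt) : Smooth2 U (Jdet xt yt) :=
  ContDiffOn.sub
    (ContDiffOn.mul (smooth2_Jmat hU hxt hyt 0 0) (smooth2_Jmat hU hxt hyt 1 1))
    (ContDiffOn.mul (smooth2_Jmat hU hxt hyt 0 1) (smooth2_Jmat hU hxt hyt 1 0))

theorem coef_law {U Ut : Set (ℝ × ℝ)} (hU : IsOpen U) (hUt : IsOpen Ut)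
    {xt yt : ℝ → ℝ → ℝ} (hxt : Smooth2 U xt) (hyt : Smooth2 U yt)
    (hmaps : ∀ x y : ℝ, (x, y) ∈ U → (xt x y, yt x y) ∈ Ut)
    (hdet : ∀ x y : ℝ, (x, y) ∈ U → Jdet xt yt x y ≠ 0)
    {P Q R S Pt Qt Rt St : ℝ → ℝ → ℝ}
    (hP : Smooth2 U P) (hQ : Smooth2 U Q) (hR : Smooth2 U R) (hS : Smooth2 U S)
    (hPt : Smooth2 Ut Pt) (hQt : Smooth2 Ut Qt) (hRt : Smooth2 Ut Rt) (hSt : Smooth2 Ut St)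
    (hrel : PointRelated U xt yt P Q R S Pt Qt Rt St) {x y : ℝ} (h : (x, y) ∈ U) :
    coefA P Q R S x y = Jdet xt yt x y *
      (Jmat xt yt 0 0 x y * coefA Pt Qt Rt St (xt x y) (yt x y) +
       Jmat xt yt 1 0 x y * coefB Pt Qt Rt St (xt x y) (yt x y)) ∧
    coefB P Q R S x y = Jdet xt yt x y *
      (Jmat xt yt 0 1 x y * coefA Pt Qt Rt St (xt x y) (yt x y) +
       Jmat xt yt 1 1 x y * coefB Pt Qt Rt St (xt x y) (yt x y)) := by
  obtain ⟨k1, k2, k3⟩ := smooth2_K hU hP hQ hR hS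
  obtain ⟨l1, l2, l3⟩ := smooth2_K hUt hPt hQt hRt hSt
  have hJ := smooth2_Jdet hU hxt hyt
  have hT := smooth2_Jmat hU hxt hyt
  have h3J : Smooth2 U (fun x y => 3 * Jdet xt yt x y) :=
    ContDiffOn.mul (contDiffOn_const (c := (3 : ℝ))) hJ
  have hinv : Smooth2 U (fun x y => (3 * Jdet xt yt x y)⁻¹) :=
    ContDiffOn.inv h3J (fun p hp => mul_ne_zero three_ne_zero (hdet p.1 p.2 hp))
  have hu : ∀ i, Smooth2 U (uf xt yt i) := fun i =>
    ContDiffOn.div (smooth2_pd hU hJ i) h3J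
      (fun p hp => mul_ne_zero three_ne_zero (hdet p.1 p.2 hp))
  have comp : ∀ {f : ℝ → ℝ → ℝ}, Smooth2 Ut f → Smooth2 U (fun x y => f (xt x y) (yt x y)) :=
    fun hf => smooth2_comp hxt hyt hmaps hf
  have pdt : ∀ {f : ℝ → ℝ → ℝ} (_ : Smooth2 Ut f) (i : Fin 2), Smooth2 Ut (pd i f) :=
    fun hf i => smooth2_pd hUt hf i
  have hdetcut : cut 1 _ (hT 0 0) * cut 1 _ (hT 1 1) - cut 0 _ (hT 0 1) * cut 0 _ (hT 1 0)
      = cut 1 _ hJ := by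
    apply smr_ext <;> intro x y h
    · simp only [sub_app, mul_app, cut_in _ _ _ h]; rfl
    · simp only [sub_app, mul_app, cut_out _ _ _ h]; ring
  have chain : ∀ {f : ℝ → ℝ → ℝ} (hf : Smooth2 Ut f),
      DD hU 0 (cut 0 _ (comp hf)) = cut 1 _ (hT 0 0) * cut 0 _ (comp (pdt hf 0))
        + cut 0 _ (hT 1 0) * cut 0 _ (comp (pdt hf 1)) ∧
      DD hU 1 (cut 0 _ (comp hf)) = cut 0 _ (hT 0 1) * cut 0 _ (comp (pdt hf 0))
        + cut 1 _ (hT 1 1) * cut 0 _ (comp (pdt hf 1)) := by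
    intro f hf
    constructor <;> rw [DD_cut] <;> apply smr_ext <;> intro x y h
    · simp only [add_app, mul_app, cut_in _ _ _ h]
      exact pd_comp hU hUt hxt hyt hmaps hf h 0
    · simp only [add_app, mul_app, cut_out _ _ _ h]; ring
    · simp only [add_app, mul_app, cut_in _ _ _ h]
      exact pd_comp hU hUt hxt hyt hmaps hf h 1
    · simp only [add_app, mul_app, cut_out _ _ _ h]; ring
  have rl := fun (x y : ℝ) (h : (x, y) ∈ U) =>
    rules hrel hdet h rfl rfl rfl rfl rfl rfl rfl rfl rfl rfl rfl rfl
  have hlog : ∀ i, DD hU i (cut 1 _ hJ) = 3 * cut 0 _ (hu i) * cut 1 _ hJ := by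
    intro i
    rw [DD_cut]
    apply smr_ext <;> intro x y h
    · simp only [mul_app, three_apply, cut_in _ _ _ h]
      have := hdet x y h
      simp only [uf]
      field_simp
    · simp only [mul_app, three_apply, cut_out _ _ _ h]; ring
  obtain ⟨e1, e2⟩ := alg_law (DD hU 0) (DD hU 1) (fun F => DD_comm hU 1 0 F)
    (cut 0 P hP) (cut 0 Q hQ) (cut 0 R hR) (cut 0 S hS)
    (cut 0 _ k1) (cut 0 _ k2) (cut 0 _ k3)
    (by
      simp only [DD_cut]
      apply smr_ext <;> intro x y h
      · simp only [add_app, sub_app, mul_app, two_apply, cut_in _ _ _ h]; rfl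
      · simp only [add_app, sub_app, mul_app, two_apply, cut_out _ _ _ h]; ring)
    (by
      simp only [DD_cut]
      apply smr_ext <;> intro x y h
      · simp only [add_app, sub_app, mul_app, cut_in _ _ _ h]; rfl
      · simp only [add_app, sub_app, mul_app, cut_out _ _ _ h]; ring)
    (by
      simp only [DD_cut]
      apply smr_ext <;> intro x y h
      · simp only [add_app, sub_app, mul_app, two_apply, cut_in _ _ _ h]; rfl
      · simp only [add_app, sub_app, mul_app, two_apply, cut_out _ _ _ h]; ring)
    (cut 1 _ (hT 0 0)) (cut 0 _ (hT 0 1)) (cut 0 _ (hT 1 0)) (cut 1 _ (hT 1 1))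
    (cut 0 _ (hu 0)) (cut 0 _ (hu 1))
    (by
      rw [hdetcut]
      refine IsUnit.of_mul_eq_one (cut (3⁻¹) _ hinv) ?_
      apply smr_ext <;> intro x y h
      · simp only [mul_app, three_apply, cut_in _ _ _ h]
        exact mul_inv_cancel₀ (mul_ne_zero three_ne_zero (hdet x y h))
      · simp only [mul_app, three_apply, cut_out _ _ _ h]
        change (3 * 1 * 3⁻¹ : ℝ) = 1
        norm_num)
    (by rw [hdetcut]; exact hlog 0)
    (by rw [hdetcut]; exact hlog 1)
    (cut 0 _ (comp hPt)) (cut 0 _ (comp hQt)) (cut 0 _ (comp hRt)) (cut 0 _ (comp hSt))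
    _ _ _ _ _ _ _ _ (cut 0 _ (comp l1)) (cut 0 _ (comp l2)) (cut 0 _ (comp l3)) _ _ _ _ _ _
    (chain hPt).1 (chain hPt).2 (chain hQt).1 (chain hQt).2
    (chain hRt).1 (chain hRt).2 (chain hSt).1 (chain hSt).2
    (by
      apply smr_ext <;> intro x y h
      · simp only [add_app, sub_app, mul_app, two_apply, cut_in _ _ _ h]; rfl
      · simp only [add_app, sub_app, mul_app, two_apply, cut_out _ _ _ h]; ring)
    (by
      apply smr_ext <;> intro x y h
      · simp only [add_app, sub_app, mul_app, cut_in _ _ _ h]; rfl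
      · simp only [add_app, sub_app, mul_app, cut_out _ _ _ h]; ring)
    (by
      apply smr_ext <;> intro x y h
      · simp only [add_app, sub_app, mul_app, two_apply, cut_in _ _ _ h]; rfl
      · simp only [add_app, sub_app, mul_app, two_apply, cut_out _ _ _ h]; ring)
    (chain l1).1 (chain l1).2 (chain l2).1 (chain l2).2 (chain l3).1 (chain l3).2
    (by
      rw [DD_cut]
      apply smr_ext <;> intro x y h
      · simp only [add_app, sub_app, mul_app, two_apply, cut_in _ _ _ h]; exact (rl x y h).1
      · simp only [add_app, sub_app, mul_app, two_apply, cut_out _ _ _ h]; ring)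
    (by
      rw [DD_cut]
      apply smr_ext <;> intro x y h
      · simp only [add_app, sub_app, mul_app, cut_in _ _ _ h]; exact (rl x y h).2.1
      · simp only [add_app, sub_app, mul_app, cut_out _ _ _ h]; ring)
    (by
      rw [DD_cut]
      apply smr_ext <;> intro x y h
      · simp only [add_app, sub_app, mul_app, cut_in _ _ _ h]; exact (rl x y h).2.2.1
      · simp only [add_app, sub_app, mul_app, cut_out _ _ _ h]; ring)
    (by
      rw [DD_cut]
      apply smr_ext <;> intro x y h
      · simp only [add_app, sub_app, mul_app, two_apply, cut_in _ _ _ h]; exact (rl x y h).2.2.2.1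
      · simp only [add_app, sub_app, mul_app, two_apply, cut_out _ _ _ h]; ring)
    (by
      rw [DD_cut]
      apply smr_ext <;> intro x y h
      · simp only [add_app, sub_app, mul_app, two_apply, cut_in _ _ _ h]; exact (rl x y h).2.2.2.2.1
      · simp only [add_app, sub_app, mul_app, two_apply, cut_out _ _ _ h]; ring)
    (by
      rw [DD_cut]
      apply smr_ext <;> intro x y h
      · simp only [add_app, sub_app, mul_app, cut_in _ _ _ h]; exact (rl x y h).2.2.2.2.2.1
      · simp only [add_app, sub_app, mul_app, cut_out _ _ _ h]; ring)
    (by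
      rw [DD_cut]
      apply smr_ext <;> intro x y h
      · simp only [add_app, sub_app, mul_app, cut_in _ _ _ h]; exact (rl x y h).2.2.2.2.2.2.1
      · simp only [add_app, sub_app, mul_app, cut_out _ _ _ h]; ring)
    (by
      rw [DD_cut]
      apply smr_ext <;> intro x y h
      · simp only [add_app, sub_app, mul_app, two_apply, cut_in _ _ _ h]
        exact (rl x y h).2.2.2.2.2.2.2
      · simp only [add_app, sub_app, mul_app, two_apply, cut_out _ _ _ h]; ring)
  rw [hdetcut] at e1 e2
  have e1' := congrArg (fun F : SmR U => F.1 x y) e1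
  have e2' := congrArg (fun F : SmR U => F.1 x y) e2
  simp only [DD_cut, add_app, sub_app, mul_app, two_apply, cut_in _ _ _ h] at e1' e2'
  obtain ⟨c1, c2⟩ := coef_K hU hP hQ hR hS h
  obtain ⟨c3, c4⟩ := coef_K hUt hPt hQt hRt hSt (hmaps x y h)
  rw [c1, c2, c3, c4]
  exact ⟨e1', e2'⟩

theorem phi_effective_formulas_A_ne_zero
    (U Ut : Set (ℝ × ℝ)) (hU : IsOpen U) (hUconn : IsConnected U) (hUt : IsOpen Ut)
    (xt yt : ℝ → ℝ → ℝ) (hxt : Smooth2 U xt) (hyt : Smooth2 U yt)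
    (hmaps : ∀ x y : ℝ, (x, y) ∈ U → (xt x y, yt x y) ∈ Ut)
    (hdet : ∀ x y : ℝ, (x, y) ∈ U → Jdet xt yt x y ≠ 0)
    (P Q R S Pt Qt Rt St : ℝ → ℝ → ℝ)
    (hP : Smooth2 U P) (hQ : Smooth2 U Q) (hR : Smooth2 U R) (hS : Smooth2 U S)
    (hPt : Smooth2 Ut Pt) (hQt : Smooth2 Ut Qt) (hRt : Smooth2 Ut Rt) (hSt : Smooth2 Ut St)
    (hrel : PointRelated U xt yt P Q R S Pt Qt Rt St)
    (hspec : ∀ x y : ℝ, (x, y) ∈ Ut →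
      coefA Pt Qt Rt St x y = 0 ∧ coefB Pt Qt Rt St x y = 1 ∧ Pt x y = 0)
    (hA : ∀ x y : ℝ, (x, y) ∈ U → coefA P Q R S x y ≠ 0) :
    ∀ x y : ℝ, (x, y) ∈ U →
      phiPull xt yt Qt Rt 0 x y =
        -3 * (coefB P Q R S x y * P x y + pdx (coefA P Q R S) x y)
            / (5 * coefA P Q R S x y)
        + (3/5) * Q x y ∧
      phiPull xt yt Qt Rt 1 x y =
        3 * coefB P Q R S x y *
            (coefB P Q R S x y * P x y + pdx (coefA P Q R S) x y)
            / (5 * (coefA P Q R S x y)^2)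
        - 3 * (pdx (coefB P Q R S) x y + pdy (coefA P Q R S) x y
            + 3 * coefB P Q R S x y * Q x y) / (5 * coefA P Q R S x y)
        + (6/5) * R x y := by
  have law : ∀ x y : ℝ, (x, y) ∈ U →
      coefA P Q R S x y = (Jdet xt yt * Jmat xt yt 1 0) x y ∧
      coefB P Q R S x y = (Jdet xt yt * Jmat xt yt 1 1) x y := by
    intro x y h
    obtain ⟨e1, e2⟩ := coef_law hU hUt hxt hyt hmaps hdet hP hQ hR hS hPt hQt hRt hSt hrel h
    obtain ⟨s1, s2, -⟩ := hspec _ _ (hmaps x y h)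
    rw [s1, s2] at e1 e2
    exact ⟨by rw [e1]; simp, by rw [e2]; simp⟩
  intro x y h
  have hJ := smooth2_Jdet hU hxt hyt
  have hT := smooth2_Jmat hU hxt hyt
  have hA0 := hA x y h
  have hJ0 := hdet x y h
  have hP0 : Pt (xt x y) (yt x y) = 0 := (hspec _ _ (hmaps x y h)).2.2
  obtain ⟨-, -, -, -, r1, r2, r3, -⟩ :=
    rules hrel hdet h rfl rfl rfl rfl rfl rfl rfl rfl hP0.symm rfl rfl rfl
  have sA : Smooth2 U (Jdet xt yt * Jmat xt yt 1 0) := ContDiffOn.mul hJ (hT 1 0)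
  have sB : Smooth2 U (Jdet xt yt * Jmat xt yt 1 1) := ContDiffOn.mul hJ (hT 1 1)
  have dA : ∀ i, pd i (coefA P Q R S) x y = _ := fun i =>
    (pd_congr hU sA (fun x y h => (law x y h).1) h i).trans (pd_mul hU hJ (hT 1 0) h i)
  have dB : ∀ i, pd i (coefB P Q R S) x y = _ := fun i =>
    (pd_congr hU sB (fun x y h => (law x y h).2) h i).trans (pd_mul hU hJ (hT 1 1) h i)
  have a1 : pdx (coefA P Q R S) x y = _ := dA 0
  have a2 : pdy (coefA P Q R S) x y = _ := dA 1
  have b1 : pdx (coefB P Q R S) x y = _ := dB 0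
  have ls : ∀ i, pd i (Jdet xt yt) x y = 3 * uf xt yt i x y * Jdet xt yt x y := by
    intro i
    simp only [uf]
    field_simp
  rw [a1, a2, b1, r1, r2, r3]
  obtain ⟨eA, eB⟩ := law x y h
  rw [eA] at hA0 ⊢
  rw [eB]
  simp only [Pi.mul_apply] at hA0 ⊢
  have hc0 : Jmat xt yt 1 0 x y ≠ 0 := right_ne_zero_of_mul hA0
  have hdetd : Jdet xt yt x y = Jmat xt yt 0 0 x y * Jmat xt yt 1 1 x y
    - Jmat xt yt 0 1 x y * Jmat xt yt 1 0 x y := rfl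
  simp only [phiPull, phiSpec, Fin.sum_univ_two, ls]
  simp only [if_true, one_ne_zero, if_false]
  constructor
  · field_simp
    ring
  · field_simp
    ring
end
end

section
/- (Case of general position: fourth frame expansion, formulas (3.8) and (3.9) for I₇ and I₈) Under the stated assumptions, ∇_Y Y = I₇·X + I₈·Y on U, where I₇ = (G·H·G_{1.0} − G²·H_{1.0} + H²·G_{0.1} − H·G·H_{0.1})/(3·F¹¹) + (G³·P + 3·G²·H·Q + 3·G·H²·R + H³·S)/(3·F¹¹) and I₈ = G·(A·G_{1.0} + B·H_{1.0})/(3·F⁹) + H·(A·G_{0.1} + B·H_{0.1})/(3·F⁹) − 10·(H·F_{0.1} + G·F_{1.0})/(3·F⁵) − B·G²·P/(3·F⁹) + (A·G² − 2·H·B·G)·Q/(3·F⁹) − (B·H² − 2·H·A·G)·R/(3·F⁹) + A·H²·S/(3·F⁹). -/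
noncomputable section

open Real

/-- The quantity `G` of formula (2.4). -/
def coefG (P Q R S : ℝ → ℝ → ℝ) : ℝ → ℝ → ℝ := fun x y =>
  -(coefB P Q R S x y) * pdx (coefB P Q R S) x y
    - 3 * coefA P Q R S x y * pdy (coefB P Q R S) x y
    + 4 * coefB P Q R S x y * pdy (coefA P Q R S) x y
    + 3 * S x y * (coefA P Q R S x y)^2
    - 6 * R x y * coefA P Q R S x y * coefB P Q R S x y
    + 3 * Q x y * (coefB P Q R S x y)^2

/-- The quantity `H` of formula (2.4). -/
def coefH (P Q R S : ℝ → ℝ → ℝ) : ℝ → ℝ → ℝ := fun x y =>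
  -(coefA P Q R S x y) * pdy (coefA P Q R S) x y
    - 3 * coefB P Q R S x y * pdx (coefA P Q R S) x y
    + 4 * coefA P Q R S x y * pdx (coefB P Q R S) x y
    - 3 * P x y * (coefB P Q R S x y)^2
    + 6 * Q x y * coefA P Q R S x y * coefB P Q R S x y
    - 3 * R x y * (coefA P Q R S x y)^2

/-- The quantity `F⁵` of formula (2.2). -/
def coefF5 (P Q R S : ℝ → ℝ → ℝ) : ℝ → ℝ → ℝ := fun x y =>
  coefA P Q R S x y * coefB P Q R S x y * pdy (coefA P Q R S) x y
    + coefA P Q R S x y * coefB P Q R S x y * pdx (coefB P Q R S) x y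
    - (coefA P Q R S x y)^2 * pdy (coefB P Q R S) x y
    - (coefB P Q R S x y)^2 * pdx (coefA P Q R S) x y
    - P x y * (coefB P Q R S x y)^3
    + 3 * Q x y * coefA P Q R S x y * (coefB P Q R S x y)^2
    - 3 * R x y * (coefA P Q R S x y)^2 * coefB P Q R S x y
    + S x y * (coefA P Q R S x y)^3

/-- The affine connection `Γ^k_{ij} = θ^k_{ij} − (φ_i δ^k_j + φ_j δ^k_i)/3` of (3.3)/(4.22). -/
def gamConn (P Q R S phi1 phi2 : ℝ → ℝ → ℝ) (k i j : Fin 2) : ℝ → ℝ → ℝ := fun x y =>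
  thetaUp P Q R S k i j x y -
    ((if i = 0 then phi1 x y else phi2 x y) * (if k = j then (1:ℝ) else 0)
      + (if j = 0 then phi1 x y else phi2 x y) * (if k = i then (1:ℝ) else 0)) / 3

/-- Covariant derivative `(∇_V W)^k = Σ_i V^i (∂W^k/∂x^i + Σ_s Γ^k_{is} W^s)`. -/
def covD (Gam : Fin 2 → Fin 2 → Fin 2 → ℝ → ℝ → ℝ) (V W : Fin 2 → ℝ → ℝ → ℝ)
    (k : Fin 2) : ℝ → ℝ → ℝ := fun x y =>
  ∑ i : Fin 2, V i x y * (pd i (W k) x y + ∑ s : Fin 2, Gam k i s x y * W s x y)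

/-- The fifth root `F = (F⁵)^{1/5}` (real power), for the case of general position `F⁵ > 0`. -/
def frF (P Q R S : ℝ → ℝ → ℝ) : ℝ → ℝ → ℝ := fun x y =>
  (coefF5 P Q R S x y) ^ ((1:ℝ)/5)

/-- `φ₁ = −F_{1.0}/F`. -/
def phiGP1 (P Q R S : ℝ → ℝ → ℝ) : ℝ → ℝ → ℝ := fun x y =>
  -(pdx (frF P Q R S) x y / frF P Q R S x y)

/-- `φ₂ = −F_{0.1}/F`. -/
def phiGP2 (P Q R S : ℝ → ℝ → ℝ) : ℝ → ℝ → ℝ := fun x y =>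
  -(pdy (frF P Q R S) x y / frF P Q R S x y)

/-- The vector field `X = F⁻²·(B, −A)` of (3.4). -/
def frameX (P Q R S : ℝ → ℝ → ℝ) (k : Fin 2) : ℝ → ℝ → ℝ := fun x y =>
  (if k = 0 then coefB P Q R S x y else -(coefA P Q R S x y)) / (frF P Q R S x y)^2

/-- The vector field `Y = F⁻⁴·(G, H)` of (3.4). -/
def frameY (P Q R S : ℝ → ℝ → ℝ) (k : Fin 2) : ℝ → ℝ → ℝ := fun x y =>
  (if k = 0 then coefG P Q R S x y else coefH P Q R S x y) / (frF P Q R S x y)^4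

/-- The invariant `I₆` in the simplified form (3.11). -/
def inv6 (P Q R S : ℝ → ℝ → ℝ) : ℝ → ℝ → ℝ := fun x y =>
  (pdy (coefA P Q R S) x y - pdx (coefB P Q R S) x y) / (3 * (frF P Q R S x y)^2)
    - (coefA P Q R S x y * pdy (frF P Q R S) x y
        - coefB P Q R S x y * pdx (frF P Q R S) x y) / (3 * (frF P Q R S x y)^3)

/-- The invariant `I₇` of formula (3.8). -/
def inv7 (P Q R S : ℝ → ℝ → ℝ) : ℝ → ℝ → ℝ := fun x y =>
  (coefG P Q R S x y * coefH P Q R S x y * pdx (coefG P Q R S) x y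
      - (coefG P Q R S x y)^2 * pdx (coefH P Q R S) x y
      + (coefH P Q R S x y)^2 * pdy (coefG P Q R S) x y
      - coefH P Q R S x y * coefG P Q R S x y * pdy (coefH P Q R S) x y)
    / (3 * (frF P Q R S x y)^11)
  + ((coefG P Q R S x y)^3 * P x y
      + 3 * (coefG P Q R S x y)^2 * coefH P Q R S x y * Q x y
      + 3 * coefG P Q R S x y * (coefH P Q R S x y)^2 * R x y
      + (coefH P Q R S x y)^3 * S x y)
    / (3 * (frF P Q R S x y)^11)

/-- The invariant `I₈` of formula (3.9). -/
def inv8 (P Q R S : ℝ → ℝ → ℝ) : ℝ → ℝ → ℝ := fun x y =>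
  coefG P Q R S x y * (coefA P Q R S x y * pdx (coefG P Q R S) x y
      + coefB P Q R S x y * pdx (coefH P Q R S) x y) / (3 * (frF P Q R S x y)^9)
  + coefH P Q R S x y * (coefA P Q R S x y * pdy (coefG P Q R S) x y
      + coefB P Q R S x y * pdy (coefH P Q R S) x y) / (3 * (frF P Q R S x y)^9)
  - 10 * (coefH P Q R S x y * pdy (frF P Q R S) x y
      + coefG P Q R S x y * pdx (frF P Q R S) x y) / (3 * (frF P Q R S x y)^5)
  - coefB P Q R S x y * (coefG P Q R S x y)^2 * P x y / (3 * (frF P Q R S x y)^9)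
  + (coefA P Q R S x y * (coefG P Q R S x y)^2
      - 2 * coefH P Q R S x y * coefB P Q R S x y * coefG P Q R S x y) * Q x y
      / (3 * (frF P Q R S x y)^9)
  - (coefB P Q R S x y * (coefH P Q R S x y)^2
      - 2 * coefH P Q R S x y * coefA P Q R S x y * coefG P Q R S x y) * R x y
      / (3 * (frF P Q R S x y)^9)
  + coefA P Q R S x y * (coefH P Q R S x y)^2 * S x y / (3 * (frF P Q R S x y)^9)

lemma Smooth2.pdx' {U : Set (ℝ × ℝ)} (hU : IsOpen U) {f : ℝ → ℝ → ℝ} (hf : Smooth2 U f) :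
    Smooth2 U (pdx f) := by
  have h1 : ContDiffOn ℝ (⊤ : ℕ∞) (fun p => fderiv ℝ (Function.uncurry f) p (1, 0)) U :=
    (ContDiffOn.fderiv_of_isOpen (m := (⊤ : ℕ∞)) hf hU (by simp)).clm_apply contDiffOn_const
  refine h1.congr ?_
  rintro ⟨x, y⟩ hp
  have hd : HasFDerivAt (Function.uncurry f) (fderiv ℝ (Function.uncurry f) (x, y)) (x, y) :=
    ((hf.contDiffAt (hU.mem_nhds hp)).differentiableAt (by simp)).hasFDerivAt
  have hl : HasDerivAt (fun t : ℝ => (t, y)) ((1 : ℝ), (0 : ℝ)) x :=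
    (hasDerivAt_id x).prodMk (hasDerivAt_const x y)
  exact (hd.comp_hasDerivAt x hl).deriv

lemma Smooth2.pdy' {U : Set (ℝ × ℝ)} (hU : IsOpen U) {f : ℝ → ℝ → ℝ} (hf : Smooth2 U f) :
    Smooth2 U (pdy f) := by
  have h1 : ContDiffOn ℝ (⊤ : ℕ∞) (fun p => fderiv ℝ (Function.uncurry f) p (0, 1)) U :=
    (ContDiffOn.fderiv_of_isOpen (m := (⊤ : ℕ∞)) hf hU (by simp)).clm_apply contDiffOn_const
  refine h1.congr ?_
  rintro ⟨x, y⟩ hp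
  have hd : HasFDerivAt (Function.uncurry f) (fderiv ℝ (Function.uncurry f) (x, y)) (x, y) :=
    ((hf.contDiffAt (hU.mem_nhds hp)).differentiableAt (by simp)).hasFDerivAt
  have hl : HasDerivAt (fun t : ℝ => (x, t)) ((0 : ℝ), (1 : ℝ)) y :=
    (hasDerivAt_const y x).prodMk (hasDerivAt_id y)
  exact (hd.comp_hasDerivAt y hl).deriv

lemma Smooth2.hasX {U : Set (ℝ × ℝ)} (hU : IsOpen U) {f : ℝ → ℝ → ℝ} (hf : Smooth2 U f)
    {x y : ℝ} (hp : (x, y) ∈ U) : HasDerivAt (fun t => f t y) (pdx f x y) x := by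
  have hd : DifferentiableAt ℝ (Function.uncurry f) (x, y) :=
    (hf.contDiffAt (hU.mem_nhds hp)).differentiableAt (by simp)
  have hl : DifferentiableAt ℝ (fun t : ℝ => (t, y)) x := by fun_prop
  exact (DifferentiableAt.comp (f := fun t : ℝ => (t, y)) x hd hl).hasDerivAt

lemma Smooth2.hasY {U : Set (ℝ × ℝ)} (hU : IsOpen U) {f : ℝ → ℝ → ℝ} (hf : Smooth2 U f)
    {x y : ℝ} (hp : (x, y) ∈ U) : HasDerivAt (fun t => f x t) (pdy f x y) y := by
  have hd : DifferentiableAt ℝ (Function.uncurry f) (x, y) :=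
    (hf.contDiffAt (hU.mem_nhds hp)).differentiableAt (by simp)
  have hl : DifferentiableAt ℝ (fun t : ℝ => (x, t)) y := by fun_prop
  exact (DifferentiableAt.comp (f := fun t : ℝ => (x, t)) y hd hl).hasDerivAt

lemma Smooth2.add {U : Set (ℝ × ℝ)} {f g : ℝ → ℝ → ℝ} (hf : Smooth2 U f) (hg : Smooth2 U g) :
    Smooth2 U (fun x y => f x y + g x y) := ContDiffOn.add hf hg

lemma Smooth2.sub {U : Set (ℝ × ℝ)} {f g : ℝ → ℝ → ℝ} (hf : Smooth2 U f) (hg : Smooth2 U g) :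
    Smooth2 U (fun x y => f x y - g x y) := ContDiffOn.sub hf hg

lemma Smooth2.mul {U : Set (ℝ × ℝ)} {f g : ℝ → ℝ → ℝ} (hf : Smooth2 U f) (hg : Smooth2 U g) :
    Smooth2 U (fun x y => f x y * g x y) := ContDiffOn.mul hf hg

lemma Smooth2.neg {U : Set (ℝ × ℝ)} {f : ℝ → ℝ → ℝ} (hf : Smooth2 U f) :
    Smooth2 U (fun x y => -f x y) := ContDiffOn.neg hf

lemma Smooth2.pow {U : Set (ℝ × ℝ)} {f : ℝ → ℝ → ℝ} (hf : Smooth2 U f) (n : ℕ) :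
    Smooth2 U (fun x y => f x y ^ n) := ContDiffOn.pow hf n

lemma Smooth2.const {U : Set (ℝ × ℝ)} (c : ℝ) : Smooth2 U (fun _ _ => c) := contDiffOn_const

/-- Bundle of all the smoothness facts needed. -/
lemma smooth_all (U : Set (ℝ × ℝ)) (hU : IsOpen U) (P Q R S : ℝ → ℝ → ℝ)
    (hP : Smooth2 U P) (hQ : Smooth2 U Q) (hR : Smooth2 U R) (hS : Smooth2 U S)
    (hpos : ∀ x y : ℝ, (x, y) ∈ U → 0 < coefF5 P Q R S x y) :
    Smooth2 U (coefG P Q R S) ∧ Smooth2 U (coefH P Q R S) ∧ Smooth2 U (frF P Q R S) := by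
  have hA : Smooth2 U (coefA P Q R S) := by
    unfold coefA
    repeat' (first
      | assumption
      | apply Smooth2.pdx' hU
      | apply Smooth2.pdy' hU
      | exact Smooth2.const _
      | apply Smooth2.add
      | apply Smooth2.sub
      | apply Smooth2.mul
      | apply Smooth2.neg)
  have hB : Smooth2 U (coefB P Q R S) := by
    unfold coefB
    repeat' (first
      | assumption
      | apply Smooth2.pdx' hU
      | apply Smooth2.pdy' hU
      | exact Smooth2.const _
      | apply Smooth2.add
      | apply Smooth2.sub
      | apply Smooth2.mul
      | apply Smooth2.neg)
  have hF5 : Smooth2 U (coefF5 P Q R S) := by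
    unfold coefF5
    repeat' (first
      | assumption
      | apply Smooth2.pdx' hU
      | apply Smooth2.pdy' hU
      | exact Smooth2.const _
      | apply Smooth2.add
      | apply Smooth2.sub
      | apply Smooth2.mul
      | apply Smooth2.pow
      | apply Smooth2.neg)
  refine ⟨?_, ?_, ?_⟩
  · unfold coefG
    repeat' (first
      | assumption
      | apply Smooth2.pdx' hU
      | apply Smooth2.pdy' hU
      | exact Smooth2.const _
      | apply Smooth2.add
      | apply Smooth2.sub
      | apply Smooth2.mul
      | apply Smooth2.pow
      | apply Smooth2.neg)
  · unfold coefH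
    repeat' (first
      | assumption
      | apply Smooth2.pdx' hU
      | apply Smooth2.pdy' hU
      | exact Smooth2.const _
      | apply Smooth2.add
      | apply Smooth2.sub
      | apply Smooth2.mul
      | apply Smooth2.pow
      | apply Smooth2.neg)
  · exact ContDiffOn.rpow_const_of_ne hF5 (fun p hp => ne_of_gt (hpos p.1 p.2 hp))

/-- Fourth frame expansion of (3.5): `∇_Y Y = I₇·X + I₈·Y` (formulas (3.8), (3.9)). -/
theorem frame_expansion_YY
    (U : Set (ℝ × ℝ)) (hU : IsOpen U) (hUconn : IsConnected U)
    (P Q R S : ℝ → ℝ → ℝ)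
    (hP : Smooth2 U P) (hQ : Smooth2 U Q) (hR : Smooth2 U R) (hS : Smooth2 U S)
    (hpos : ∀ x y : ℝ, (x, y) ∈ U → 0 < coefF5 P Q R S x y) :
    ∀ k : Fin 2, ∀ x y : ℝ, (x, y) ∈ U →
      covD (gamConn P Q R S (phiGP1 P Q R S) (phiGP2 P Q R S))
          (frameY P Q R S) (frameY P Q R S) k x y
        = inv7 P Q R S x y * frameX P Q R S k x y
          + inv8 P Q R S x y * frameY P Q R S k x y := by
  intro k x y hp
  obtain ⟨hG, hH, hF⟩ := smooth_all U hU P Q R S hP hQ hR hS hpos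
  have hF5 := hpos x y hp
  have hF0 : frF P Q R S x y ≠ 0 := (Real.rpow_pos_of_pos hF5 _).ne'
  have hFpow : frF P Q R S x y ^ 5 = coefF5 P Q R S x y := by
    unfold frF
    rw [← Real.rpow_natCast, ← Real.rpow_mul hF5.le]
    norm_num
  have key : coefA P Q R S x y * coefG P Q R S x y + coefB P Q R S x y * coefH P Q R S x y
      = 3 * frF P Q R S x y ^ 5 := by
    rw [hFpow]; unfold coefG coefH coefF5; ring
  have dGx : pdx (fun x y => coefG P Q R S x y / frF P Q R S x y ^ 4) x y = _ :=
    ((hG.hasX hU hp).div ((hF.hasX hU hp).pow 4) (pow_ne_zero 4 hF0)).deriv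
  have dGy : pdy (fun x y => coefG P Q R S x y / frF P Q R S x y ^ 4) x y = _ :=
    ((hG.hasY hU hp).div ((hF.hasY hU hp).pow 4) (pow_ne_zero 4 hF0)).deriv
  have dHx : pdx (fun x y => coefH P Q R S x y / frF P Q R S x y ^ 4) x y = _ :=
    ((hH.hasX hU hp).div ((hF.hasX hU hp).pow 4) (pow_ne_zero 4 hF0)).deriv
  have dHy : pdy (fun x y => coefH P Q R S x y / frF P Q R S x y ^ 4) x y = _ :=
    ((hH.hasY hU hp).div ((hF.hasY hU hp).pow 4) (pow_ne_zero 4 hF0)).deriv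
  have y0 : frameY P Q R S 0 = fun x y => coefG P Q R S x y / frF P Q R S x y ^ 4 := by
    funext a b; simp [frameY]
  have y1 : frameY P Q R S 1 = fun x y => coefH P Q R S x y / frF P Q R S x y ^ 4 := by
    funext a b; simp [frameY]
  rw [← y0] at dGx dGy
  rw [← y1] at dHx dHy
  have px : ∀ f, pd 0 f = pdx f := fun f => by simp [pd]
  have py : ∀ f, pd 1 f = pdy f := fun f => by simp [pd]
  have e0 : frameY P Q R S 0 x y = coefG P Q R S x y / frF P Q R S x y ^ 4 := by rw [y0]
  have e1 : frameY P Q R S 1 x y = coefH P Q R S x y / frF P Q R S x y ^ 4 := by rw [y1]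
  have x0 : frameX P Q R S 0 x y = coefB P Q R S x y / frF P Q R S x y ^ 2 := by simp [frameX]
  have x1 : frameX P Q R S 1 x y = -coefA P Q R S x y / frF P Q R S x y ^ 2 := by simp [frameX]
  clear y0 y1 hG hH hF hFpow hF5 hpos
  fin_cases k
  · simp only [covD, Fin.sum_univ_two, Fin.zero_eta, Fin.isValue, px, py, dGx, dGy, e0, e1, x0,
      gamConn, thetaUp, thetaLow, phiGP1, phiGP2, inv7, inv8]
    simp
    generalize coefA P Q R S x y = A at *
    generalize coefB P Q R S x y = B at *
    generalize pdx (coefG P Q R S) x y = Gx at *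
    generalize pdy (coefG P Q R S) x y = Gy at *
    generalize pdx (coefH P Q R S) x y = Hx at *
    generalize pdy (coefH P Q R S) x y = Hy at *
    generalize coefG P Q R S x y = G at *
    generalize coefH P Q R S x y = H at *
    generalize pdx (frF P Q R S) x y = Fx at *
    generalize pdy (frF P Q R S) x y = Fy at *
    generalize frF P Q R S x y = F at *
    generalize P x y = p at *
    generalize Q x y = q at *
    generalize R x y = r at *
    generalize S x y = s at *
    clear dGx dGy dHx dHy e0 e1 x0 x1
    field_simp
    linear_combination (-1) * (G * Gx + H * Gy + q * G ^ 2 + 2 * r * G * H + s * H ^ 2) * key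
  · simp only [covD, Fin.sum_univ_two, Fin.mk_one, Fin.isValue, px, py, dHx, dHy, e0, e1, x1,
      gamConn, thetaUp, thetaLow, phiGP1, phiGP2, inv7, inv8]
    simp
    generalize coefA P Q R S x y = A at *
    generalize coefB P Q R S x y = B at *
    generalize pdx (coefG P Q R S) x y = Gx at *
    generalize pdy (coefG P Q R S) x y = Gy at *
    generalize pdx (coefH P Q R S) x y = Hx at *
    generalize pdy (coefH P Q R S) x y = Hy at *
    generalize coefG P Q R S x y = G at *
    generalize coefH P Q R S x y = H at *
    generalize pdx (frF P Q R S) x y = Fx at *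
    generalize pdy (frF P Q R S) x y = Fy at *
    generalize frF P Q R S x y = F at *
    generalize P x y = p at *
    generalize Q x y = q at *
    generalize R x y = r at *
    generalize S x y = s at *
    clear dGx dGy dHx dHy e0 e1 x0 x1
    field_simp
    linear_combination (-1) * (G * Hx + H * Hy - p * G ^ 2 - 2 * q * G * H - r * H ^ 2) * key
end
end
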